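/- arXiv:2203.12841 — 4 statements merged into one kernel-verified Lean document; each statement's English description precedes it below -/
import Mathlib

section
/- Let a, b ∈ M_{d₁}(ℝ), c ∈ M_{d₂,d₁}(ℝ), and let Σ ∈ M_{d₂}(ℝ) be symmetric positive definite, and suppose bb' is positive definite. If γ ∈ M_{d₁}(ℝ) is a symmetric solution of the algebraic Riccati equation −aγ − γa' − γc'Σ⁻¹cγ + bb' = 0 such that every complex eigenvalue of α = a + γc'Σ⁻¹c has positive real part, then γ is positive definite. -/
open Matrix

/-- A Lyapunov-type criterion on an invariant subspace: if `T` preserves `W`, all eigenvalues of `T`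
on `W` have positive real part and `re (B x (T x)) > 0` for nonzero `x ∈ W`, then the Hermitian
form `B` is positive on `W`. -/
theorem re_apply_self_pos_of_eigenvalue_re_pos {V : Type*} [AddCommGroup V] [Module ℂ V]
    [FiniteDimensional ℂ V] (B : V →ₗ⋆[ℂ] V →ₗ[ℂ] ℂ)
    (hB : ∀ x y, star (B x y) = B y x) (W : Submodule ℂ V) (T : V →ₗ[ℂ] V)
    (hTW : ∀ x ∈ W, T x ∈ W) (hT : ∀ x ∈ W, x ≠ 0 → 0 < (B x (T x)).re)
    (heig : ∀ μ : ℂ, ∀ x ∈ W, x ≠ 0 → T x = μ • x → 0 < μ.re) :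
    ∀ x ∈ W, x ≠ 0 → 0 < (B x x).re := by
  have hreal (x : V) : (B x x).im = 0 := Complex.conj_eq_iff_im.mp (hB x x)
  induction hn : Module.finrank ℂ W using Nat.strong_induction_on generalizing W T with
  | _ n ih =>
  intro x hx hx0
  have : Nontrivial W := ⟨⟨x, hx⟩, 0, fun h => hx0 (congrArg Subtype.val h)⟩
  obtain ⟨l, hl⟩ := Module.End.exists_eigenvalue (T.restrict hTW)
  obtain ⟨⟨v, hvW⟩, hv⟩ := hl.exists_hasEigenvector
  have hv0 : v ≠ 0 := fun h => hv.2 (Subtype.ext h)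
  have hTv : T v = l • v := congrArg Subtype.val hv.apply_eq_smul
  have hlpos : 0 < l.re := heig l v hvW hv0 hTv
  have hvv : 0 < (B v v).re := by
    have h := hT v hvW hv0
    rw [hTv, map_smul, smul_eq_mul, Complex.mul_re, hreal v, mul_zero, sub_zero] at h
    exact (pos_iff_pos_of_mul_pos h).mp hlpos
  have hvne : B v v ≠ 0 := fun h => by simp [h] at hvv
  let T' : V →ₗ[ℂ] V := T - ((B v v)⁻¹ • (B v ∘ₗ T)).smulRight v
  have hT' (y : V) : T' y = T y - ((B v v)⁻¹ * B v (T y)) • v := rfl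
  have hpos : ∀ y ∈ W ⊓ LinearMap.ker (B v), y ≠ 0 → 0 < (B y y).re := by
    refine ih _ ?_ _ T' ?_ ?_ ?_ rfl
    · rw [← hn]
      refine Submodule.finrank_lt_finrank_of_lt (lt_of_le_of_ne inf_le_left fun h => hvne ?_)
      exact (h.ge hvW).2
    · rintro y ⟨hy, -⟩
      refine ⟨hT' y ▸ W.sub_mem (hTW y hy) (W.smul_mem _ hvW), ?_⟩
      rw [SetLike.mem_coe, LinearMap.mem_ker, hT', map_sub, map_smul, smul_eq_mul]
      field_simp
      ring
    · rintro y ⟨hy, hyv⟩ hy0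
      have : B y v = 0 := by rw [← hB, LinearMap.mem_ker.mp hyv, star_zero]
      rw [hT', map_sub, map_smul, this, smul_zero, sub_zero]
      exact hT y hy hy0
    · rintro μ y ⟨hy, hyv⟩ hy0 hμ
      by_cases hne : μ = l
      · exact hne ▸ hlpos
      have hne' : μ - l ≠ 0 := sub_ne_zero.mpr hne
      rw [hT', sub_eq_iff_eq_add] at hμ
      set k := (B v v)⁻¹ * B v (T y)
      refine heig μ (y + (k / (μ - l)) • v) (W.add_mem hy (W.smul_mem _ hvW)) (fun h => hy0 ?_) ?_
      · have hk := congrArg (B v) h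
        rw [map_add, LinearMap.mem_ker.mp hyv, map_smul, smul_eq_mul, zero_add, map_zero,
          mul_eq_zero, or_iff_left hvne] at hk
        simpa [hk] using h
      · rw [map_add, map_smul, hμ, hTv]
        match_scalars
        · ring
        · field_simp
          ring
  set k := (B v v)⁻¹ * B v x with hk
  set y := x - k • v with hy
  have hyv : B v y = 0 := by
    rw [hy, map_sub, map_smul, hk, smul_eq_mul]
    field_simp
    ring
  have hyv' : B y v = 0 := by rw [← hB, hyv, star_zero]
  have hyW : y ∈ W ⊓ LinearMap.ker (B v) := ⟨W.sub_mem hx (W.smul_mem _ hvW), hyv⟩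
  have hxy : x = y + k • v := by rw [hy]; abel
  have hxx : (B x x).re = (B y y).re + Complex.normSq k * (B v v).re := by
    rw [hxy]
    simp [hyv, hyv', ← mul_assoc, Complex.mul_re, hreal v, Complex.normSq_apply]
  rw [hxx]
  by_cases hy0 : y = 0
  · have hk0 : k ≠ 0 := fun h => hx0 (by rw [hxy, hy0, h, zero_smul, add_zero])
    have := Complex.normSq_pos.mpr hk0
    rw [hy0, map_zero, Complex.zero_re, zero_add]
    positivity
  · have := hpos y hyW hy0
    have := Complex.normSq_nonneg k
    positivity

/-- The sesquilinear form `(x, y) ↦ x* M y` of a complex square matrix. -/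
noncomputable def Matrix.starDotForm {n : Type*} [Fintype n] (M : Matrix n n ℂ) :
    (n → ℂ) →ₗ⋆[ℂ] (n → ℂ) →ₗ[ℂ] ℂ :=
  LinearMap.mk₂'ₛₗ (starRingEnd ℂ) (RingHom.id ℂ) (fun x y => star x ⬝ᵥ (M *ᵥ y))
    (fun x y z => by rw [star_add, add_dotProduct])
    (fun k x y => by rw [star_smul, smul_dotProduct]; rfl)
    (fun x y z => by rw [mulVec_add, dotProduct_add])
    (fun k x y => by rw [mulVec_smul, dotProduct_smul]; rfl)

theorem Matrix.re_star_dotProduct_map_ofReal_mulVec {n : Type*} [Fintype n]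
    (M : Matrix n n ℝ) (x : n → ℂ) :
    (star x ⬝ᵥ (M.map Complex.ofReal *ᵥ x)).re =
      (fun i => (x i).re) ⬝ᵥ (M *ᵥ fun i => (x i).re) +
        (fun i => (x i).im) ⬝ᵥ (M *ᵥ fun i => (x i).im) := by
  simp [dotProduct, mulVec, Finset.sum_add_distrib, Complex.mul_re]

/-- **Lyapunov's theorem**: if all eigenvalues of `α` have positive real part and `γαᵀ` is positive
as a quadratic form, for a symmetric `γ`, then `γ` is positive. -/
theorem Matrix.dotProduct_mulVec_pos_of_lyapunov {n : Type*} [Fintype n] [DecidableEq n]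
    (α γ : Matrix n n ℝ) (hγ : γ.IsSymm)
    (hpos : ∀ x : n → ℝ, x ≠ 0 → 0 < x ⬝ᵥ ((γ * αᵀ) *ᵥ x))
    (heig : ∀ μ ∈ spectrum ℂ (α.map Complex.ofReal), 0 < μ.re) (x : n → ℝ) (hx : x ≠ 0) :
    0 < x ⬝ᵥ (γ *ᵥ x) := by
  have hherm : (γ.map Complex.ofReal)ᴴ = γ.map Complex.ofReal := by
    ext i j
    simp [hγ.apply i j]
  have key := re_apply_self_pos_of_eigenvalue_re_pos (starDotForm (γ.map Complex.ofReal))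
    (fun x y => ?_) ⊤ (mulVecLin (αᵀ.map Complex.ofReal)) (fun _ _ => trivial) ?_ ?_
    (fun i => (x i : ℂ)) trivial
    (fun h => hx (funext fun i => Complex.ofReal_eq_zero.mp (congrFun h i)))
  · have h := re_star_dotProduct_map_ofReal_mulVec γ (fun i => (x i : ℂ))
    simp only [Complex.ofReal_re, Complex.ofReal_im] at h
    rw [show (fun _ : n => (0 : ℝ)) = 0 from rfl, zero_dotProduct, add_zero] at h
    exact h ▸ key
  · change star (star x ⬝ᵥ _) = star y ⬝ᵥ _
    rw [← star_dotProduct_star, star_star, star_mulVec, hherm, ← dotProduct_mulVec]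
  · intro z _ hz
    change 0 < (star z ⬝ᵥ (_ *ᵥ (_ *ᵥ z))).re
    rw [mulVec_mulVec, show γ.map Complex.ofReal * αᵀ.map Complex.ofReal =
      (γ * αᵀ).map Complex.ofReal from (Matrix.map_mul (f := Complex.ofRealHom)).symm,
      re_star_dotProduct_map_ofReal_mulVec]
    have hnonneg (u : n → ℝ) : 0 ≤ u ⬝ᵥ ((γ * αᵀ) *ᵥ u) := by
      by_cases hu : u = 0
      · simp [hu]
      · exact (hpos u hu).le
    by_cases hre : (fun i => (z i).re) = 0
    · refine add_pos_of_nonneg_of_pos (hnonneg _) (hpos _ fun him => hz ?_)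
      exact funext fun i => Complex.ext (congrFun hre i) (congrFun him i)
    · exact add_pos_of_pos_of_nonneg (hpos _ hre) (hnonneg _)
  · intro μ z _ hz hμ
    refine heig μ ?_
    rw [spectrum.mem_iff, Matrix.isUnit_iff_isUnit_det, isUnit_iff_ne_zero, not_not,
      ← det_transpose, ← exists_mulVec_eq_zero_iff]
    refine ⟨z, hz, ?_⟩
    rw [transpose_sub, algebraMap_eq_diagonal, diagonal_transpose, ← transpose_map, sub_mulVec,
      ← mulVecLin_apply (αᵀ.map _), hμ, sub_eq_zero]
    ext i
    simp [mulVec_diagonal]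

/-- If `bb'` is positive definite and `γ` is a symmetric solution of the algebraic Riccati
equation `−aγ − γa' − γc'Σ⁻¹cγ + bb' = 0` such that all complex eigenvalues of
`α = a + γc'Σ⁻¹c` have positive real part, then `γ` is positive definite. -/
theorem stmt5 (d₁ d₂ : ℕ) (a b : Matrix (Fin d₁) (Fin d₁) ℝ) (c : Matrix (Fin d₂) (Fin d₁) ℝ)
    (Sg : Matrix (Fin d₂) (Fin d₂) ℝ) (hSg : Sg.PosDef)
    (hbb : ∀ x : Fin d₁ → ℝ, x ≠ 0 → 0 < x ⬝ᵥ ((b * bᵀ) *ᵥ x))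
    (γ : Matrix (Fin d₁) (Fin d₁) ℝ) (hγ : γ.IsSymm)
    (hRic : -(a * γ) - γ * aᵀ - γ * cᵀ * Sg⁻¹ * c * γ + b * bᵀ = 0)
    (α : Matrix (Fin d₁) (Fin d₁) ℝ) (hα : α = a + γ * cᵀ * Sg⁻¹ * c)
    (heig : ∀ μ ∈ spectrum ℂ (α.map (Complex.ofReal)), 0 < μ.re) :
    ∀ x : Fin d₁ → ℝ, x ≠ 0 → 0 < x ⬝ᵥ (γ *ᵥ x) := by
  refine dotProduct_mulVec_pos_of_lyapunov α γ hγ (fun x hx => ?_) heig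
  have hSinv : (Sg⁻¹)ᵀ = Sg⁻¹ := by simpa using hSg.inv.isHermitian.eq
  have hlyap : α * γ + γ * αᵀ = b * bᵀ + γ * cᵀ * Sg⁻¹ * c * γ := by
    have hb : b * bᵀ = a * γ + γ * aᵀ + γ * cᵀ * Sg⁻¹ * c * γ := by
      rw [← sub_eq_zero, ← hRic]; abel
    rw [hb, hα]
    simp only [transpose_add, transpose_mul, transpose_transpose, hSinv, hγ.eq, add_mul, mul_add,
      Matrix.mul_assoc]
    abel
  have htr : x ⬝ᵥ ((α * γ) *ᵥ x) = x ⬝ᵥ ((γ * αᵀ) *ᵥ x) := by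
    rw [dotProduct_mulVec, ← mulVec_transpose, transpose_mul, hγ.eq, dotProduct_comm]
  have hquad : 0 ≤ x ⬝ᵥ ((γ * cᵀ * Sg⁻¹ * c * γ) *ᵥ x) := by
    have h := hSg.inv.posSemidef.dotProduct_mulVec_nonneg ((c * γ) *ᵥ x)
    rw [star_trivial, mulVec_mulVec, dotProduct_comm, dotProduct_mulVec, ← mulVec_transpose,
      mulVec_mulVec, dotProduct_comm] at h
    simpa only [transpose_mul, hγ.eq, Matrix.mul_assoc] using h
  have h := congrArg (fun M => x ⬝ᵥ (M *ᵥ x)) hlyap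
  simp only [add_mulVec, dotProduct_add, htr] at h
  linarith [hbb x hx]
end

section
/- Let a, b ∈ M_{d₁}(ℝ), c ∈ M_{d₂,d₁}(ℝ), and let Σ ∈ M_{d₂}(ℝ) be symmetric positive definite, and suppose bb' is positive definite. If γ ∈ M_{d₁}(ℝ) is a symmetric solution of the algebraic Riccati equation −aγ − γa' − γc'Σ⁻¹cγ + bb' = 0 such that every complex eigenvalue of α = a + γc'Σ⁻¹c has negative real part, then γ is negative definite. -/
open Matrix

open Filter Topology in
/-- In a complex Banach algebra, the powers of an element whose spectrum lies in the open unit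
disc tend to zero. -/
theorem tendsto_pow_nhds_zero_of_spectrum_norm_lt_one {A : Type*} [NormedRing A]
    [NormedAlgebra ℂ A] [CompleteSpace A] (a : A) (h : ∀ z ∈ spectrum ℂ a, ‖z‖ < 1) :
    Tendsto (fun n : ℕ => a ^ n) atTop (𝓝 0) := by
  nontriviality A
  have hr : spectralRadius ℂ a < (1 : NNReal) :=
    spectrum.spectralRadius_lt_of_forall_lt a fun z hz => by
      rw [← NNReal.coe_lt_coe]; simpa using h z hz
  obtain ⟨r, har, hr1⟩ := ENNReal.lt_iff_exists_nnreal_btwn.1 hr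
  have hlt : r < 1 := by exact_mod_cast hr1
  have hev : ∀ᶠ n : ℕ in atTop, ‖a ^ n‖ ≤ (r : ℝ) ^ n := by
    have hG := spectrum.pow_nnnorm_pow_one_div_tendsto_nhds_spectralRadius a
    filter_upwards [hG.eventually_lt_const har, eventually_gt_atTop 0] with n hn hn0
    have hpow := pow_le_pow_left₀ zero_le hn.le n
    rw [← ENNReal.rpow_natCast, ← ENNReal.rpow_mul, one_div,
      inv_mul_cancel₀ (by exact_mod_cast hn0.ne'), ENNReal.rpow_one] at hpow
    exact_mod_cast hpow
  exact squeeze_zero_norm' hev (tendsto_pow_atTop_nhds_zero_of_lt_one r.2 (by exact_mod_cast hlt))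

/-- The Cayley transform `(μ - 1) / (μ + 1)` of a point outside the open unit disc has
nonnegative real part. -/
theorem Complex.re_sub_one_div_add_one_nonneg {z : ℂ} (hz : 1 ≤ ‖z‖) :
    0 ≤ ((z - 1) / (z + 1)).re := by
  have h : 1 ≤ z.re * z.re + z.im * z.im := by
    rw [← Complex.normSq_apply, Complex.normSq_eq_norm_sq]
    nlinarith
  rw [Complex.div_re, ← add_div]
  refine div_nonneg ?_ (Complex.normSq_nonneg _)
  simp
  nlinarith

namespace Matrix

variable {n : Type*} [Fintype n] [DecidableEq n]

/-- A matrix `R` with `R (1 - A) = 1 + A`, where all eigenvalues of `A` have negative real part,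
has its eigenvalues in the open unit disc. -/
theorem norm_lt_one_of_mem_spectrum_cayley {A R : Matrix n n ℂ}
    (hA : ∀ μ ∈ spectrum ℂ A, μ.re < 0) (hR : R * (1 - A) = 1 + A) {z : ℂ}
    (hz : z ∈ spectrum ℂ R) : ‖z‖ < 1 := by
  by_contra! h
  refine hz ?_
  have key : (algebraMap ℂ (Matrix n n ℂ) z - R) * (1 - A) = (z - 1) • 1 - (z + 1) • A := by
    rw [sub_mul, hR, Algebra.algebraMap_eq_smul_one]
    simp only [smul_mul_assoc, one_mul, smul_sub, sub_smul, add_smul, one_smul]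
    abel
  suffices hU : IsUnit ((z - 1) • (1 : Matrix n n ℂ) - (z + 1) • A) by
    rw [← key, isUnit_iff_isUnit_det, det_mul] at hU
    exact (isUnit_iff_isUnit_det _).2 (isUnit_of_mul_isUnit_left hU)
  by_cases hz1 : z + 1 = 0
  · have hz2 : z - 1 ≠ 0 := fun h0 => by
      have : (2 : ℂ) = 0 := by linear_combination hz1 - h0
      norm_num at this
    rw [hz1, zero_smul, sub_zero]
    exact isUnit_one.smul (Units.mk0 _ hz2)
  · have hres : IsUnit (algebraMap ℂ (Matrix n n ℂ) ((z - 1) / (z + 1)) - A) := by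
      by_contra hn
      exact absurd (hA _ hn) (not_lt.2 (Complex.re_sub_one_div_add_one_nonneg h))
    have hU := hres.smul (Units.mk0 _ hz1)
    rw [Units.smul_mk0, Algebra.algebraMap_eq_smul_one, smul_sub, smul_smul,
      mul_div_cancel₀ _ hz1] at hU
    exact hU

open Filter Topology in
open scoped Matrix.Norms.Operator in
/-- The powers of a real matrix whose complex eigenvalues lie in the open unit disc tend to
zero. -/
theorem tendsto_pow_nhds_zero {R : Matrix n n ℝ}
    (hR : ∀ z ∈ spectrum ℂ (R.map Complex.ofReal), ‖z‖ < 1) :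
    Tendsto (fun k : ℕ => R ^ k) atTop (𝓝 0) := by
  have h := tendsto_pow_nhds_zero_of_spectrum_norm_lt_one _ hR
  have hc : Continuous fun M : Matrix n n ℂ => M.map Complex.re :=
    continuous_id.matrix_map Complex.continuous_re
  have hre := (hc.tendsto 0).comp h
  convert hre using 2 with k
  · have : (R ^ k).map Complex.ofReal = R.map Complex.ofReal ^ k :=
      Matrix.map_pow R Complex.ofRealHom k
    ext i j
    simp [← this]
  · ext i j
    simp

open Filter Topology in
/-- Lyapunov's theorem: if all eigenvalues of `A` have negative real part and the quadratic form
of `γ A + Aᵀ γ` is positive definite, then that of `γ` is negative definite. -/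
theorem dotProduct_mulVec_neg_of_lyapunov {A γ : Matrix n n ℝ}
    (hA : ∀ μ ∈ spectrum ℂ (A.map Complex.ofReal), μ.re < 0)
    (hQ : ∀ x : n → ℝ, x ≠ 0 → 0 < x ⬝ᵥ ((γ * A + Aᵀ * γ) *ᵥ x)) {x : n → ℝ} (hx : x ≠ 0) :
    x ⬝ᵥ (γ *ᵥ x) < 0 := by
  have hmap : ((1 : Matrix n n ℝ) - A).map Complex.ofReal = 1 - A.map Complex.ofReal := by
    rw [Matrix.map_sub _ (by simp), Matrix.map_one _ (by simp) (by simp)]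
  have hmap_add : ((1 : Matrix n n ℝ) + A).map Complex.ofReal = 1 + A.map Complex.ofReal := by
    rw [Matrix.map_add _ (by simp), Matrix.map_one _ (by simp) (by simp)]
  have hdet : IsUnit (1 - A).det := by
    have h1 : IsUnit (1 - A.map Complex.ofReal) := by
      by_contra hn
      have h := hA 1 (by rwa [spectrum.mem_iff, map_one])
      norm_num at h
    rw [isUnit_iff_isUnit_det, ← hmap] at h1
    have h2 : Complex.ofRealHom (1 - A).det = ((1 - A).map Complex.ofReal).det :=
      RingHom.map_det Complex.ofRealHom _
    rw [← h2] at h1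
    exact (isUnit_map_iff Complex.ofRealHom _).1 h1
  set R := (1 + A) * (1 - A)⁻¹ with hRdef
  have hR : R * (1 - A) = 1 + A := nonsing_inv_mul_cancel_right _ _ hdet
  have hRC : R.map Complex.ofReal * (1 - A.map Complex.ofReal) = 1 + A.map Complex.ofReal := by
    rw [← hmap, ← hmap_add, ← hR]
    exact (Matrix.map_mul (f := Complex.ofRealHom)).symm
  have hpow : Tendsto (fun k : ℕ => R ^ k) atTop (𝓝 0) :=
    tendsto_pow_nhds_zero fun z hz => norm_lt_one_of_mem_spectrum_cayley hA hRC hz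
  let V : (n → ℝ) → ℝ := fun y => y ⬝ᵥ (γ *ᵥ y)
  have hV : Continuous V := by fun_prop
  have hincr : ∀ z : n → ℝ, z ≠ 0 → V z < V (R *ᵥ z) := by
    intro z hz
    obtain ⟨y, rfl⟩ : ∃ y, z = (1 - A) *ᵥ y :=
      ⟨(1 - A)⁻¹ *ᵥ z, by rw [mulVec_mulVec, mul_nonsing_inv _ hdet, one_mulVec]⟩
    have hy : y ≠ 0 := by rintro rfl; simp at hz
    have hform : ∀ B : Matrix n n ℝ, V (B *ᵥ y) = y ⬝ᵥ ((Bᵀ * γ * B) *ᵥ y) := by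
      intro B
      simp only [V]
      rw [← mulVec_mulVec, ← mulVec_mulVec, dotProduct_mulVec y, vecMul_transpose]
    rw [mulVec_mulVec, hR, hform, hform, ← sub_pos, ← dotProduct_sub, ← sub_mulVec]
    have : (1 + A)ᵀ * γ * (1 + A) - (1 - A)ᵀ * γ * (1 - A) = (2 : ℝ) • (γ * A + Aᵀ * γ) := by
      rw [transpose_add, transpose_sub, transpose_one, two_smul]
      noncomm_ring
    rw [this, smul_mulVec, dotProduct_smul]
    exact mul_pos two_pos (hQ y hy)
  have hmono : ∀ z : n → ℝ, V z ≤ V (R *ᵥ z) := by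
    intro z
    rcases eq_or_ne z 0 with rfl | hz
    · simp
    · exact (hincr z hz).le
  have hlim : Tendsto (fun k : ℕ => V (R ^ k *ᵥ x)) atTop (𝓝 0) := by
    have hc : Continuous fun M : Matrix n n ℝ => V (M *ᵥ x) := by fun_prop
    have h := (hc.tendsto 0).comp hpow
    simpa [V, Function.comp_def] using h
  have hseq : Monotone fun k : ℕ => V (R ^ k *ᵥ x) :=
    monotone_nat_of_le_succ fun k => by
      rw [pow_succ', ← mulVec_mulVec]
      exact hmono _
  calc V x < V (R ^ 1 *ᵥ x) := by simpa using hincr x hx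
    _ ≤ 0 := hseq.ge_of_tendsto hlim 1

end Matrix

/-- If `bb'` is positive definite and `γ` is a symmetric solution of the algebraic Riccati
equation `−aγ − γa' − γc'Σ⁻¹cγ + bb' = 0` such that all complex eigenvalues of
`α = a + γc'Σ⁻¹c` have negative real part, then `γ` is negative definite. -/
theorem stmt6 (d₁ d₂ : ℕ) (a b : Matrix (Fin d₁) (Fin d₁) ℝ) (c : Matrix (Fin d₂) (Fin d₁) ℝ)
    (Sg : Matrix (Fin d₂) (Fin d₂) ℝ) (hSg : Sg.PosDef)
    (hbb : ∀ x : Fin d₁ → ℝ, x ≠ 0 → 0 < x ⬝ᵥ ((b * bᵀ) *ᵥ x))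
    (γ : Matrix (Fin d₁) (Fin d₁) ℝ) (hγ : γ.IsSymm)
    (hRic : -(a * γ) - γ * aᵀ - γ * cᵀ * Sg⁻¹ * c * γ + b * bᵀ = 0)
    (α : Matrix (Fin d₁) (Fin d₁) ℝ) (hα : α = a + γ * cᵀ * Sg⁻¹ * c)
    (heig : ∀ μ ∈ spectrum ℂ (α.map (Complex.ofReal)), μ.re < 0) :
    ∀ x : Fin d₁ → ℝ, x ≠ 0 → x ⬝ᵥ (γ *ᵥ x) < 0 := by
  have hP : (Sg⁻¹).PosSemidef := hSg.posSemidef.inv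
  have hPt : (Sg⁻¹)ᵀ = Sg⁻¹ := by
    simpa [conjTranspose_eq_transpose_of_trivial] using hP.isHermitian.eq
  have hspec : ∀ μ ∈ spectrum ℂ (αᵀ.map Complex.ofReal), μ.re < 0 := by
    refine fun μ hμ => heig μ fun hU => hμ ?_
    rw [spectrum.mem_resolventSet_iff, ← isUnit_transpose, transpose_sub,
      Algebra.algebraMap_eq_smul_one, transpose_smul, transpose_one] at hU
    rwa [spectrum.mem_resolventSet_iff, Algebra.algebraMap_eq_smul_one]
  have hlyap : γ * αᵀ + αᵀᵀ * γ = b * bᵀ + (c * γ)ᵀ * Sg⁻¹ * (c * γ) := by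
    have hαt : αᵀ = aᵀ + cᵀ * Sg⁻¹ * c * γ := by
      rw [hα]
      simp only [transpose_add, transpose_mul, transpose_transpose, hPt, hγ.eq, Matrix.mul_assoc]
    rw [transpose_transpose, hαt, hα, transpose_mul, hγ.eq]
    rw [← sub_eq_zero, ← neg_eq_zero, ← hRic]
    simp only [Matrix.mul_add, Matrix.add_mul, Matrix.mul_assoc]
    abel
  refine fun x hx => dotProduct_mulVec_neg_of_lyapunov hspec (fun y hy => ?_) hx
  rw [hlyap, add_mulVec, dotProduct_add]
  refine add_pos_of_pos_of_nonneg (hbb y hy) ?_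
  have h := hP.dotProduct_mulVec_nonneg ((c * γ) *ᵥ y)
  rwa [star_trivial, ← vecMul_transpose, ← dotProduct_mulVec, vecMul_transpose, mulVec_mulVec,
    mulVec_mulVec] at h
end

section
/- Let θ*, θ, M be real numbers with θ* > 0 and 0 < θ ≤ M. Then −(1/2)·((θ*/θ)² − 1 − 2·log(θ*/θ)) ≤ −(θ − θ*)²/(2M²). -/
/-- Identifiability bound for the one-dimensional criterion function `𝕐₁`:
for `θ* > 0` and `0 < θ ≤ M`,
`−(1/2)((θ*/θ)² − 1 − 2 log(θ*/θ)) ≤ −(θ − θ*)²/(2M²)`. -/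
theorem stmt12 (θstar θ M : ℝ) (hθstar : 0 < θstar) (hθ : 0 < θ) (hM : θ ≤ M) :
    -(1 / 2) * ((θstar / θ) ^ 2 - 1 - 2 * Real.log (θstar / θ))
      ≤ -(θ - θstar) ^ 2 / (2 * M ^ 2) := by
  have hlog := Real.log_le_sub_one_of_pos (div_pos hθstar hθ)
  have hsq : (θ - θstar) ^ 2 / M ^ 2 ≤ (θstar / θ - 1) ^ 2 := by
    calc (θ - θstar) ^ 2 / M ^ 2 ≤ (θ - θstar) ^ 2 / θ ^ 2 := by gcongr
      _ = (θstar / θ - 1) ^ 2 := by field_simp; ring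
  have hhalf : -(θ - θstar) ^ 2 / (2 * M ^ 2) = -(1 / 2) * ((θ - θstar) ^ 2 / M ^ 2) := by
    ring
  rw [hhalf]
  linarith
end

section
/- Let Θ₂ ⊆ ℝ^{m₂} be a bounded set, θ₂* ∈ Θ₂, and let a, α : Θ₂ → ℝ be functions for which there exist constants 0 < κ₁ ≤ κ₂ and c₀ > 0 such that κ₁ ≤ a(θ) ≤ κ₂, κ₁ ≤ α(θ) ≤ κ₂ and α(θ)/a(θ) − 1 ≥ c₀ for all θ ∈ Θ₂. Write a* = a(θ₂*), α* = α(θ₂*), and define 𝕐 : Θ₂ → ℝ by 𝕐(θ) = −(a*·a(θ)²/(4α(θ)(a* + α(θ))))·(α(θ)/a(θ) − α*/a*)² − (1/(4a*α(θ)(a* + α(θ))))·(α(θ) − a(θ) − α* + a*)². If there exists C > 0 such that |a(θ) − a*| + |α(θ) − α*| ≥ C·|θ − θ₂*| for all θ ∈ Θ₂, then there exists C' > 0 such that 𝕐(θ) ≤ −C'·|θ − θ₂*|² for all θ ∈ Θ₂. -/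
/-- If `α₀ / a₀ - 1 ≥ c`, then the deviations of `(a, α)` from `(a₀, α₀)` are controlled by those
of the ratio `α / a` and of the difference `α - a`. -/
theorem mul_abs_sub_add_abs_sub_le {a α a₀ α₀ c κ : ℝ} (ha : 0 < a) (haκ : a ≤ κ) (ha₀ : 0 < a₀)
    (hc : 0 < c) (hratio : c ≤ α₀ / a₀ - 1) :
    c * (|a - a₀| + |α - α₀|) ≤
      (c + 2 + 2 * κ) * (|α / a - α₀ / a₀| + |α - a - α₀ + a₀|) := by
  set u := α / a - α₀ / a₀ with hu
  set v := α - a - α₀ + a₀ with hv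
  have key : (α₀ / a₀ - 1) * (a - a₀) = v - a * u := by
    rw [hu, hv]
    field_simp
    ring
  have h₁ : c * |a - a₀| ≤ |v| + κ * |u| := calc
    c * |a - a₀| ≤ (α₀ / a₀ - 1) * |a - a₀| := by gcongr
    _ = |v - a * u| := by rw [← key, abs_mul, abs_of_pos (hc.trans_le hratio)]
    _ ≤ |v| + |a * u| := abs_sub _ _
    _ = |v| + a * |u| := by rw [abs_mul, abs_of_pos ha]
    _ ≤ |v| + κ * |u| := by gcongr
  have h₂ : |α - α₀| ≤ |v| + |a - a₀| := by
    have : α - α₀ = v + (a - a₀) := by rw [hv]; ring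
    rw [this]
    exact abs_add_le _ _
  have hκ : 0 < κ := ha.trans_le haκ
  have := mul_le_mul_of_nonneg_left h₂ hc.le
  have := mul_nonneg hc.le (abs_nonneg u)
  have := mul_nonneg hκ.le (abs_nonneg v)
  linarith [abs_nonneg u]


/-- Identifiability of the one-dimensional criterion function `𝕐₂`: if `a` and `α` are bounded
above and below by positive constants on the bounded set `Θ₂`, `α/a − 1` is bounded below by a
positive constant, and `|a(θ) − a*| + |α(θ) − α*| ≥ C|θ − θ₂*|`, then
`𝕐(θ) ≤ −C'|θ − θ₂*|²` on `Θ₂` for some `C' > 0`. -/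
theorem stmt14 (m₂ : ℕ) (Θ₂ : Set (EuclideanSpace ℝ (Fin m₂)))
    (hΘbdd : Bornology.IsBounded Θ₂)
    (θstar : EuclideanSpace ℝ (Fin m₂)) (hθstar : θstar ∈ Θ₂)
    (a α : EuclideanSpace ℝ (Fin m₂) → ℝ) (κ₁ κ₂ c₀ : ℝ)
    (hκ₁ : 0 < κ₁) (hκ₁₂ : κ₁ ≤ κ₂) (hc₀ : 0 < c₀)
    (ha : ∀ θ ∈ Θ₂, κ₁ ≤ a θ ∧ a θ ≤ κ₂)
    (hα : ∀ θ ∈ Θ₂, κ₁ ≤ α θ ∧ α θ ≤ κ₂)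
    (hratio : ∀ θ ∈ Θ₂, c₀ ≤ α θ / a θ - 1)
    (Y : EuclideanSpace ℝ (Fin m₂) → ℝ)
    (hY : ∀ θ, Y θ =
      -(a θstar * (a θ) ^ 2 / (4 * α θ * (a θstar + α θ))) *
          (α θ / a θ - α θstar / a θstar) ^ 2
        - (1 / (4 * a θstar * α θ * (a θstar + α θ))) *
          (α θ - a θ - α θstar + a θstar) ^ 2)
    (C : ℝ) (hC : 0 < C)
    (hsep : ∀ θ ∈ Θ₂, C * ‖θ - θstar‖ ≤ |a θ - a θstar| + |α θ - α θstar|) :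
    ∃ C' : ℝ, 0 < C' ∧ ∀ θ ∈ Θ₂, Y θ ≤ -C' * ‖θ - θstar‖ ^ 2 := by
  have hκ₂ : 0 < κ₂ := hκ₁.trans_le hκ₁₂
  obtain ⟨has, has'⟩ := ha θstar hθstar
  have has₀ : 0 < a θstar := hκ₁.trans_le has
  set K := c₀ + 2 + 2 * κ₂ with hK
  have hK₀ : 0 < K := by positivity
  set m := min (κ₁ * κ₁ ^ 2 / (4 * κ₂ * (κ₂ + κ₂))) (1 / (4 * κ₂ * κ₂ * (κ₂ + κ₂))) with hm
  have hm₀ : 0 < m := lt_min (by positivity) (by positivity)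
  refine ⟨m * ((c₀ * C) ^ 2 / (2 * K ^ 2)), by positivity, fun θ hθ => ?_⟩
  obtain ⟨haθ, haθ'⟩ := ha θ hθ
  obtain ⟨hαθ, hαθ'⟩ := hα θ hθ
  have haθ₀ : 0 < a θ := hκ₁.trans_le haθ
  have hαθ₀ : 0 < α θ := hκ₁.trans_le hαθ
  have hdev := mul_abs_sub_add_abs_sub_le (α := α θ) haθ₀ haθ' has₀ hc₀ (hratio θstar hθstar)
  rw [hY]
  set u := α θ / a θ - α θstar / a θstar
  set v := α θ - a θ - α θstar + a θstar
  have hA : m ≤ a θstar * (a θ) ^ 2 / (4 * α θ * (a θstar + α θ)) :=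
    (min_le_left _ _).trans (by gcongr)
  have hB : m ≤ 1 / (4 * a θstar * α θ * (a θstar + α θ)) :=
    (min_le_right _ _).trans (by gcongr)
  have hlin : c₀ * C * ‖θ - θstar‖ ≤ K * (|u| + |v|) := by
    refine le_trans ?_ hdev
    rw [mul_assoc]
    exact mul_le_mul_of_nonneg_left (hsep θ hθ) hc₀.le
  have hsq : (c₀ * C) ^ 2 / (2 * K ^ 2) * ‖θ - θstar‖ ^ 2 ≤ u ^ 2 + v ^ 2 := by
    rw [div_mul_eq_mul_div, div_le_iff₀ (by positivity)]
    calc (c₀ * C) ^ 2 * ‖θ - θstar‖ ^ 2 = (c₀ * C * ‖θ - θstar‖) ^ 2 := by ring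
      _ ≤ (K * (|u| + |v|)) ^ 2 := by gcongr
      _ = K ^ 2 * (|u| + |v|) ^ 2 := by ring
      _ ≤ K ^ 2 * (2 * (|u| ^ 2 + |v| ^ 2)) := by
        gcongr
        exact add_sq_le
      _ = (u ^ 2 + v ^ 2) * (2 * K ^ 2) := by
        rw [sq_abs, sq_abs]
        ring
  have := mul_le_mul_of_nonneg_left hsq hm₀.le
  have := mul_le_mul_of_nonneg_right hA (sq_nonneg u)
  have := mul_le_mul_of_nonneg_right hB (sq_nonneg v)
  linarith
end
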